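/- Let P be a non-negatively graded Noetherian ring with P_0 an Artinian local ring, and let I be a homogeneous ideal of P such that R = P/I is a Cohen-Macaulay ring of dimension one; let 𝔪 denote the maximal homogeneous ideal of R. Then b_0(I^{(2)}) ≤ max{ b_0(I) + b_0(𝔪) + a(R), 2·b_0(I) }. -/

import Mathlib

/-!
Statement 10 (Lemma `doo` of the paper).

`P` is a non-negatively graded Noetherian ring with `P₀ = 𝒜 0` an Artinian local ring,
`I` a homogeneous ideal of `P` such that `R = P/I` is Cohen–Macaulay of dimension one,
with maximal homogeneous ideal `𝔪` (the image of the maximal homogeneous ideal `𝔪_P`).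

Conclusion: `b₀(I⁽²⁾) ≤ max{ b₀(I) + b₀(𝔪) + a(R), 2·b₀(I) }`, where `I⁽²⁾` is the
second symbolic power of `I`, `b₀` is the maximal generator degree, and
`a(R) = topdeg H¹_𝔪(R)` (since `dim R = 1`).

The symbolic power is `I² R_W ∩ R` for `W` the complement of the union of the
associated primes of `I`.  The quantities `b₀` and `a(R)` are rendered in universally
quantified form:  for all upper bounds `β ≥ b₀(I)`, `δ ≥ b₀(𝔪)`, `γ ≥ a(R)` —
the latter via the Koszul-cohomology direct-limit predicate `KVanish` for
`H¹_{𝔪_P}(P/I) = H¹_𝔪(R)` — the ideal `I⁽²⁾` is generated in degrees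
`≤ max (β + δ + γ) (2 β)`.
-/

noncomputable section
namespace Paper

variable {P : Type} [CommRing P]

def maxHomIdeal (𝒜 : ℤ → AddSubgroup P) [GradedRing 𝒜] : Ideal P :=
  Ideal.span ({ r : P | ∃ h : r ∈ 𝒜 0, ¬ IsUnit (⟨r, h⟩ : 𝒜 0) } ∪
    ⋃ (i : ℤ) (_ : i ≠ 0), (𝒜 i : Set P))

/-- The ideal `J` (of the graded ring `P`) is generated in degrees at most `b`. -/
def IdealGenDegLE (𝒜 : ℤ → AddSubgroup P) (J : Ideal P) (b : ℤ) : Prop :=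
  J ≤ Ideal.span ((J : Set P) ∩ ⋃ (j : ℤ) (_ : j ≤ b), (𝒜 j : Set P))

def depthGE (I : Ideal P) (N : Type) [AddCommGroup N] [Module P N] (k : ℕ) : Prop :=
  Subsingleton N ∨ ∃ rs : List P, rs.length = k ∧ (∀ r ∈ rs, r ∈ I) ∧
    RingTheory.Sequence.IsRegular N rs

/-- The multiplicative set `W`: the complement of the union of the associated primes
of `I` (i.e. of the associated primes of the module `P/I`). -/
def assPrimeComplement (I : Ideal P) : Submonoid P where
  carrier := { w : P | ∀ Q ∈ associatedPrimes P (P ⧸ I), w ∉ Q }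
  one_mem' := by
    intro Q hQ h1
    exact hQ.1.ne_top (Ideal.eq_top_iff_one Q |>.mpr h1)
  mul_mem' := by
    intro a b ha hb Q hQ hab
    rcases hQ.1.mem_or_mem hab with h | h
    · exact ha Q hQ h
    · exact hb Q hQ h

/-- The `t`-th symbolic power `I⁽ᵗ⁾ = Iᵗ P_W ∩ P`. -/
def symbolicPower (I : Ideal P) (t : ℕ) : Ideal P :=
  Ideal.comap (algebraMap P (Localization (assPrimeComplement I)))
    (Ideal.map (algebraMap P (Localization (assPrimeComplement I))) (I ^ t))

abbrev KCochain (n : ℕ) (M : Type) (i : ℕ) : Type := {S : Finset (Fin n) // S.card = i} → M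

variable {n : ℕ} (y : Fin n → P) {M : Type} [AddCommGroup M] [Module P M]

def kd (t i : ℕ) (f : KCochain n M i) : KCochain n M (i + 1) := fun T =>
  ∑ j ∈ T.1.attach,
    ((-1 : ℤ) ^ ((T.1.filter (fun a => a < j.1)).card)) •
      ((y j.1 ^ t) • f ⟨T.1.erase j.1, by simp [Finset.card_erase_of_mem j.2, T.2]⟩)

def kTrans (s : ℕ) (i : ℕ) (f : KCochain n M i) : KCochain n M i := fun S =>
  ((∏ j ∈ S.1, y j) ^ s) • f S

def KHomog (ℳ : ℤ → AddSubgroup M) (e : Fin n → ℤ) (t : ℕ) (ℓ : ℤ) {i : ℕ}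
    (f : KCochain n M i) : Prop :=
  ∀ S, f S ∈ ℳ (ℓ + (t : ℤ) * ∑ j ∈ S.1, e j)

def IsKBoundary (t : ℕ) : (i : ℕ) → KCochain n M i → Prop
  | 0, f => f = 0
  | (i + 1), f => ∃ g : KCochain n M i, kd y t i g = f

def KVanish (ℳ : ℤ → AddSubgroup M) (e : Fin n → ℤ) (i : ℕ) (ℓ : ℤ) : Prop :=
  ∀ (t : ℕ) (f : KCochain n M i), kd y t i f = 0 → KHomog ℳ e t ℓ f →
    ∃ s : ℕ, IsKBoundary y (t + s) i (kTrans y s i f)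

/-- Vanishing of first local cohomology in degree `ℓ`, in terms of compatible families of fractions
`v j / y j ^ t`: each such family comes from an element of the quotient ring. -/
theorem exists_of_kVanish_one {𝒜 : ℤ → AddSubgroup P} {I : Ideal P} {m : ℕ} {y : Fin m → P}
    {e : Fin m → ℤ} {ℓ : ℤ}
    (hK : KVanish y (fun j => AddSubgroup.map (Ideal.Quotient.mk I).toAddMonoidHom (𝒜 j)) e 1 ℓ)
    (t : ℕ) (v : Fin m → P) (hv : ∀ j, v j ∈ 𝒜 (ℓ + t * e j))
    (hcomm : ∀ i j, y i ^ t * v j - y j ^ t * v i ∈ I) :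
    ∃ (s : ℕ) (g : P), ∀ j, y j ^ (t + s) * g - y j ^ s * v j ∈ I := by
  let f : KCochain m (P ⧸ I) 1 := fun S => Ideal.Quotient.mk I (∑ j ∈ S.1, v j)
  have hf : kd y t 1 f = 0 := by
    funext T
    obtain ⟨T, hT⟩ := T
    change ∑ j ∈ T.attach, (fun j => ((-1 : ℤ) ^ ((T.filter (fun a => a < j)).card)) •
      ((y j ^ t) • Ideal.Quotient.mk I (∑ i ∈ T.erase j, v i))) j.1 = 0
    rw [Finset.sum_attach T (fun j => ((-1 : ℤ) ^ ((T.filter (fun a => a < j)).card)) •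
      ((y j ^ t) • Ideal.Quotient.mk I (∑ i ∈ T.erase j, v i)))]
    obtain ⟨a, b, hab, rfl⟩ : ∃ a b, a < b ∧ T = {a, b} := by
      obtain ⟨a, b, hne, rfl⟩ := Finset.card_eq_two.1 hT
      rcases lt_or_gt_of_ne hne with h | h
      · exact ⟨a, b, h, rfl⟩
      · exact ⟨b, a, h, Finset.pair_comm a b⟩
    have h1 : ({a, b} : Finset (Fin m)).filter (fun c => c < a) = ∅ := by grind
    have h2 : ({a, b} : Finset (Fin m)).filter (fun c => c < b) = {a} := by grind
    have h3 : ({a, b} : Finset (Fin m)).erase a = {b} := by grind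
    have h4 : ({a, b} : Finset (Fin m)).erase b = {a} := by grind
    rw [Finset.sum_pair hab.ne, h1, h2, h3, h4]
    simp only [Finset.card_empty, pow_zero, one_smul, Finset.card_singleton, pow_one, neg_smul,
      Finset.sum_singleton, ← sub_eq_add_neg]
    exact sub_eq_zero.2 (Ideal.Quotient.eq.2 (hcomm a b))
  have hhom : KHomog (fun j => AddSubgroup.map (Ideal.Quotient.mk I).toAddMonoidHom (𝒜 j))
      e t ℓ f := by
    rintro ⟨S, hS⟩
    obtain ⟨a, rfl⟩ := Finset.card_eq_one.1 hS
    refine ⟨v a, ?_, ?_⟩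
    · simpa using hv a
    · simp [f]
  obtain ⟨s, g, hg⟩ := hK t f hf hhom
  obtain ⟨g0, hg0⟩ := Ideal.Quotient.mk_surjective (g ⟨∅, rfl⟩)
  refine ⟨s, g0, fun j => ?_⟩
  have h1 := congrFun hg ⟨{j}, Finset.card_singleton j⟩
  change ∑ i ∈ ({j} : Finset (Fin m)).attach, _ = ((∏ i ∈ ({j} : Finset (Fin m)), y i) ^ s) •
    Ideal.Quotient.mk I (∑ i ∈ {j}, v i) at h1
  rw [Finset.prod_singleton, Finset.sum_singleton, Finset.sum_eq_single ⟨j, by simp⟩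
    (by rintro ⟨i, hi⟩ _ hne; exact absurd (Subtype.ext (Finset.mem_singleton.1 hi)) hne)
    (by simp)] at h1
  have h2 : (Finset.filter (fun a => a < j) ({j} : Finset (Fin m))) = ∅ := by grind
  have h3 : ∀ (S : {S : Finset (Fin m) // S.card = 0}), g S = Ideal.Quotient.mk I g0 := by
    rintro ⟨S, hS⟩
    obtain rfl := Finset.card_eq_zero.1 hS
    exact hg0.symm
  simp only [h2, h3, Finset.card_empty, pow_zero, one_smul] at h1
  exact Ideal.Quotient.eq.1 h1

section Graded

open DirectSum

variable {𝒜 : ℤ → AddSubgroup P} [GradedRing 𝒜]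

/-- If `p` has no components above degree `d` and `p * g` lies in a homogeneous ideal, then so does
the product of `g` with some power of the component of `p` in degree `d`. -/
theorem exists_pow_decompose_mul_mem {L : Ideal P} (hL : L.IsHomogeneous 𝒜) {p g : P} {d : ℤ}
    (hp : ∀ i, d < i → (decompose 𝒜 p i : P) = 0) (hpg : p * g ∈ L) :
    ∃ N : ℕ, (decompose 𝒜 p d : P) ^ N * g ∈ L := by
  classical
  set s := (decompose 𝒜 g).support with hs
  have hsum : ∑ j ∈ s, (decompose 𝒜 g j : P) = g := sum_support_decompose 𝒜 g
  have hzero : ∀ i, i ∉ s → (decompose 𝒜 g i : P) = 0 := by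
    intro i hi
    simpa [hs, DFinsupp.mem_support_iff] using hi
  obtain ⟨B, hB⟩ := s.exists_le
  have key : ∀ (k : ℕ) (i : ℤ), B - k < i →
      (decompose 𝒜 p d : P) ^ k * (decompose 𝒜 g i : P) ∈ L := by
    intro k
    induction k with
    | zero =>
      intro i hi
      rw [hzero i fun h => by have := hB i h; simp at hi; omega, mul_zero]
      exact L.zero_mem
    | succ k ih =>
      intro i hi
      rw [pow_succ, mul_comm (_ ^ k), mul_assoc]
      by_cases hik : B - k < i
      · exact L.mul_mem_left _ (ih i hik)
      by_cases his : i ∈ s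
      swap
      · rw [hzero i his, mul_zero, mul_zero]
        exact L.zero_mem
      have h1 : (decompose 𝒜 (p * g) (d + i) : P) =
          ∑ j ∈ s, (decompose 𝒜 p (d + i - j) : P) * (decompose 𝒜 g j : P) := by
        conv_lhs => rw [← hsum, Finset.mul_sum, decompose_sum, DFinsupp.finsetSum_apply]
        rw [AddSubgroup.val_finsetSum]
        refine Finset.sum_congr rfl fun j _ => ?_
        conv_lhs => rw [show d + i = (d + i - j) + j by ring]
        exact coe_decompose_mul_add_of_right_mem 𝒜 (SetLike.coe_mem _)
      have h2 := L.mul_mem_left ((decompose 𝒜 p d : P) ^ k) (hL (d + i) hpg)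
      rw [h1, ← Finset.add_sum_erase s _ his, mul_add, add_sub_cancel_right] at h2
      rw [mul_left_comm]
      refine (Submodule.add_mem_iff_left L ?_).1 h2
      rw [Finset.mul_sum]
      refine L.sum_mem fun j hj => ?_
      rcases lt_or_gt_of_ne (Finset.ne_of_mem_erase hj) with hji | hji
      · rw [hp (d + i - j) (by omega), zero_mul, mul_zero]
        exact L.zero_mem
      · rw [mul_left_comm]
        exact L.mul_mem_left _ (ih j (by push_cast at hi; omega))
  obtain ⟨A, hA⟩ := s.exists_le (α := ℤᵒᵈ)
  refine ⟨(B - OrderDual.ofDual A + 1).toNat, ?_⟩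
  have h3 : ∑ j ∈ s, (decompose 𝒜 p d : P) ^ (B - OrderDual.ofDual A + 1).toNat *
      (decompose 𝒜 g j : P) ∈ L := by
    refine L.sum_mem fun j hj => key _ _ ?_
    have h1 : OrderDual.ofDual A ≤ j := hA j hj
    have h2 := hB j hj
    omega
  rwa [← Finset.mul_sum, hsum] at h3

theorem mem_of_mem_associatedPrimes [IsNoetherianRing P] {L Q : Ideal P}
    (hQ : Q ∈ associatedPrimes P (P ⧸ L)) : ∃ g : P, ∀ p, p ∈ Q ↔ p * g ∈ L := by
  obtain ⟨-, x, hx⟩ := isAssociatedPrime_iff.1 hQ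
  obtain ⟨g, rfl⟩ := Ideal.Quotient.mk_surjective x
  refine ⟨g, fun p => ?_⟩
  rw [hx, Submodule.mem_colon_singleton, Submodule.mem_bot, ← Ideal.Quotient.eq_zero_iff_mem,
    map_mul]
  rfl

theorem isHomogeneous_of_mem_associatedPrimes [IsNoetherianRing P] {L Q : Ideal P}
    (hL : L.IsHomogeneous 𝒜) (hQ : Q ∈ associatedPrimes P (P ⧸ L)) : Q.IsHomogeneous 𝒜 := by
  classical
  obtain ⟨g, hg⟩ := mem_of_mem_associatedPrimes hQ
  have hprime : Q.IsPrime := hQ.1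
  have key : ∀ (k : ℕ) (p : P), p ∈ Q → (decompose 𝒜 p).support.card ≤ k →
      ∀ i, (decompose 𝒜 p i : P) ∈ Q := by
    intro k
    induction k with
    | zero =>
      intro p _ hk i
      have : decompose 𝒜 p = 0 := by simpa using hk
      simp [this]
    | succ k ih =>
      intro p hp hk i
      rcases (decompose 𝒜 p).support.eq_empty_or_nonempty with h0 | hne
      · have : decompose 𝒜 p = 0 := by simpa using h0
        simp [this]
      set d := (decompose 𝒜 p).support.max' hne with hd
      have hdmem : d ∈ (decompose 𝒜 p).support := Finset.max'_mem _ _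
      have htop : (decompose 𝒜 p d : P) ∈ Q := by
        obtain ⟨N, hN⟩ := exists_pow_decompose_mul_mem (𝒜 := 𝒜) hL (p := p) (g := g) (d := d)
          (fun j hj => by
            by_contra hne0
            have : j ∈ (decompose 𝒜 p).support := by
              simpa [DFinsupp.mem_support_iff] using hne0
            exact absurd (Finset.le_max' _ _ this) (not_le.2 hj)) ((hg p).1 hp)
        exact hprime.mem_of_pow_mem N ((hg _).2 hN)
      have hdec : decompose 𝒜 (p - decompose 𝒜 p d) = (decompose 𝒜 p).erase d := by
        ext j
        rw [decompose_sub, decompose_coe, DFinsupp.sub_apply, DFinsupp.erase_apply]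
        split_ifs with hj
        · subst hj; simp
        · rw [of_eq_of_ne _ _ _ hj]; simp
      by_cases hid : i = d
      · rw [hid]; exact htop
      have h3 := ih (p - decompose 𝒜 p d) (Q.sub_mem hp htop) (by
        rw [hdec, DFinsupp.support_erase, Finset.card_erase_of_mem hdmem]
        omega) i
      rwa [hdec, DFinsupp.erase_ne hid] at h3
  intro i p hp
  exact key _ p hp le_rfl i

theorem mem_of_mul_mem_of_associatedPrimes [IsNoetherianRing P] {L : Ideal P} {w f : P}
    (hw : ∀ Q ∈ associatedPrimes P (P ⧸ L), w ∉ Q) (hf : w * f ∈ L) : f ∈ L := by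
  by_contra hfL
  obtain ⟨Q, hQ, hle⟩ := exists_le_isAssociatedPrime_of_isNoetherianRing P
    (Ideal.Quotient.mk L f) (by rwa [Ne, Ideal.Quotient.eq_zero_iff_mem])
  refine hw Q hQ (hle ?_)
  rw [Submodule.mem_colon_singleton, Submodule.mem_bot]
  exact Ideal.Quotient.eq_zero_iff_mem.2 hf

/-- Homogeneous prime avoidance. -/
theorem exists_homogeneous_notMem (hnonneg : ∀ i : ℤ, i < 0 → 𝒜 i = ⊥) (S : Finset (Ideal P))
    (hprime : ∀ Q ∈ S, Q.IsPrime) (hhom : ∀ Q ∈ S, Q.IsHomogeneous 𝒜)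
    (hpos : ∀ Q ∈ S, ∃ d : ℕ, 0 < d ∧ ∃ h ∈ 𝒜 d, h ∉ Q) :
    ∃ d : ℕ, 0 < d ∧ ∃ x ∈ 𝒜 d, ∀ Q ∈ S, x ∉ Q := by
  classical
  induction hk : S.card generalizing S with
  | zero =>
    obtain rfl := Finset.card_eq_zero.1 hk
    exact ⟨1, one_pos, 0, (𝒜 _).zero_mem, by simp⟩
  | succ k ih =>
    obtain ⟨Q, hQ⟩ := S.exists_minimal (Finset.card_pos.1 (by omega))
    have hQS := hQ.prop
    have hQp := hprime Q hQS
    obtain ⟨d, hd, x, hx, hxS⟩ := ih (S.erase Q)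
      (fun J hJ => hprime J (Finset.mem_of_mem_erase hJ))
      (fun J hJ => hhom J (Finset.mem_of_mem_erase hJ))
      (fun J hJ => hpos J (Finset.mem_of_mem_erase hJ))
      (by rw [Finset.card_erase_of_mem hQS]; omega)
    by_cases hxQ : x ∈ Q
    swap
    · refine ⟨d, hd, x, hx, fun J hJ => ?_⟩
      by_cases hJQ : J = Q
      · rwa [hJQ]
      · exact hxS J (Finset.mem_erase.2 ⟨hJQ, hJ⟩)
    have hsep : ∀ J ∈ S.erase Q, ∃ (i : ℕ) (h : P), h ∈ 𝒜 i ∧ h ∈ J ∧ h ∉ Q := by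
      intro J hJ
      have hJS := Finset.mem_of_mem_erase hJ
      obtain ⟨p, hpJ, hpQ⟩ := SetLike.not_le_iff_exists.1 fun hle : J ≤ Q =>
        Finset.ne_of_mem_erase hJ (le_antisymm hle (hQ.le_of_le hJS hle))
      obtain ⟨i, hi⟩ : ∃ i, (decompose 𝒜 p i : P) ∉ Q := by
        by_contra! hall
        exact hpQ (((hhom Q hQS).mem_iff 𝒜).2 hall)
      have hi0 : 0 ≤ i := by
        by_contra! hneg
        have h0 : (decompose 𝒜 p i : P) ∈ 𝒜 i := SetLike.coe_mem _
        have h1 := AddSubgroup.mem_bot.1 ((hnonneg i hneg).le h0)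
        exact hi (h1 ▸ Q.zero_mem)
      lift i to ℕ using hi0
      exact ⟨i, _, SetLike.coe_mem _, hhom J hJS i hpJ, hi⟩
    choose! i h hih hhJ hhQ using hsep
    obtain ⟨c, hc, t, ht, htQ⟩ := hpos Q hQS
    have hprod : t * ∏ J ∈ S.erase Q, h J ∈ 𝒜 ((c + ∑ J ∈ S.erase Q, i J : ℕ) : ℤ) := by
      push_cast
      exact SetLike.mul_mem_graded ht (SetLike.prod_mem_graded _ _ _ hih)
    set e := c + ∑ J ∈ S.erase Q, i J with he
    set u := t * ∏ J ∈ S.erase Q, h J with hu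
    have huQ : u ∉ Q := by
      intro hmem
      rcases hQp.mem_or_mem hmem with h1 | h1
      · exact htQ h1
      · obtain ⟨J, hJ, h2⟩ := hQp.prod_mem_iff.1 h1
        exact hhQ J hJ h2
    have he0 : 0 < e := by omega
    refine ⟨e * d, Nat.mul_pos he0 hd, x ^ e + u ^ d, (𝒜 _).add_mem ?_ ?_, fun J hJ hmem => ?_⟩
    · simpa using SetLike.pow_mem_graded e hx
    · simpa [mul_comm] using SetLike.pow_mem_graded d hprod
    · have hJp := hprime J hJ
      by_cases hJQ : J = Q
      · subst hJQ
        rw [Submodule.add_mem_iff_right J (Ideal.pow_mem_of_mem _ hxQ _ he0)] at hmem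
        exact huQ (hJp.mem_of_pow_mem _ hmem)
      · have hJ' := Finset.mem_erase.2 ⟨hJQ, hJ⟩
        have huJ : u ∈ J := J.mul_mem_left _ (Ideal.prod_mem J hJ' (hhJ J hJ'))
        rw [Submodule.add_mem_iff_left J (Ideal.pow_mem_of_mem _ huJ _ hd)] at hmem
        exact hxS J hJ' (hJp.mem_of_pow_mem _ hmem)

theorem coe_decompose_mul_zero (hnonneg : ∀ i : ℤ, i < 0 → 𝒜 i = ⊥) (r a : P) :
    (decompose 𝒜 (r * a) 0 : P) = decompose 𝒜 r 0 * decompose 𝒜 a 0 := by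
  induction r using DirectSum.Decomposition.inductionOn 𝒜 with
  | zero => simp
  | @homogeneous i m =>
    rcases lt_trichotomy i 0 with hi | rfl | hi
    · have hm := AddSubgroup.mem_bot.1 ((hnonneg i hi).le m.2)
      simp [hm]
    · rw [coe_decompose_mul_of_left_mem_zero 𝒜 m.2, decompose_of_mem_same 𝒜 m.2]
    · have h1 : (decompose 𝒜 ((m : P) * a) (i + -i) : P) = m * decompose 𝒜 a (-i) :=
        coe_decompose_mul_add_of_left_mem 𝒜 m.2
      have h2 := AddSubgroup.mem_bot.1
        ((hnonneg (-i) (by omega)).le (SetLike.coe_mem (decompose 𝒜 a (-i))))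
      rw [add_neg_cancel, h2, mul_zero] at h1
      rw [h1, decompose_of_mem_ne 𝒜 m.2 hi.ne', zero_mul]
  | add r s hr hs =>
    rw [add_mul, decompose_add, decompose_add, DirectSum.add_apply, DirectSum.add_apply, AddSubgroup.coe_add,
      AddSubgroup.coe_add, hr, hs, add_mul]

theorem mem_maxHomIdeal_of_degree_ne_zero {i : ℤ} (hi : i ≠ 0) {p : P} (hp : p ∈ 𝒜 i) :
    p ∈ maxHomIdeal 𝒜 :=
  Ideal.subset_span (Or.inr (Set.mem_iUnion₂.2 ⟨i, hi, hp⟩))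

theorem maxHomIdeal_isHomogeneous : (maxHomIdeal 𝒜).IsHomogeneous 𝒜 := by
  refine Ideal.homogeneous_span 𝒜 _ ?_
  rintro p (⟨hp, -⟩ | hp)
  · exact ⟨0, hp⟩
  · obtain ⟨i, -, hp⟩ := Set.mem_iUnion₂.1 hp
    exact ⟨i, hp⟩

theorem not_isUnit_of_mem_maxHomIdeal (hnonneg : ∀ i : ℤ, i < 0 → 𝒜 i = ⊥)
    (hloc : IsLocalRing ↥(𝒜 0)) {p : P} (hp : p ∈ maxHomIdeal 𝒜) (hp0 : p ∈ 𝒜 0) :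
    ¬ IsUnit (⟨p, hp0⟩ : 𝒜 0) := by
  have key : ∀ q ∈ maxHomIdeal 𝒜, decompose 𝒜 q 0 ∈ nonunits (𝒜 0) := by
    intro q hq
    induction hq using Submodule.span_induction with
    | mem q hq =>
      rcases hq with ⟨hq, hu⟩ | hq
      · rwa [← Subtype.coe_eta (decompose 𝒜 q 0) (SetLike.coe_mem _),
          show decompose 𝒜 q 0 = ⟨q, hq⟩ from Subtype.ext (decompose_of_mem_same 𝒜 hq)]
      · obtain ⟨i, hi, hq⟩ := Set.mem_iUnion₂.1 hq
        rw [show decompose 𝒜 q 0 = 0 from Subtype.ext (decompose_of_mem_ne 𝒜 hq hi)]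
        exact zero_mem_nonunits.2 zero_ne_one
    | zero =>
      rw [decompose_zero]
      exact zero_mem_nonunits.2 zero_ne_one
    | add a b _ _ ha hb =>
      rw [decompose_add]
      exact IsLocalRing.nonunits_add ha hb
    | smul r a _ ha =>
      rw [smul_eq_mul, show decompose 𝒜 (r * a) 0 = decompose 𝒜 r 0 * decompose 𝒜 a 0 from
        Subtype.ext (coe_decompose_mul_zero hnonneg r a)]
      exact mul_mem_nonunits_right ha
  have := key p hp
  rwa [show decompose 𝒜 p 0 = ⟨p, hp0⟩ from Subtype.ext (decompose_of_mem_same 𝒜 hp0)] at this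


theorem maxHomIdeal_isPrime (hnonneg : ∀ i : ℤ, i < 0 → 𝒜 i = ⊥) (hloc : IsLocalRing ↥(𝒜 0)) :
    (maxHomIdeal 𝒜).IsPrime := by
  refine maxHomIdeal_isHomogeneous.isPrime_of_homogeneous_mem_or_mem ?_ ?_
  · intro htop
    exact not_isUnit_of_mem_maxHomIdeal hnonneg hloc ((Ideal.eq_top_iff_one _).1 htop)
      SetLike.GradedOne.one_mem isUnit_one
  · rintro a b ⟨i, ha⟩ ⟨j, hb⟩ hab
    by_cases hi : i = 0
    swap
    · exact Or.inl (mem_maxHomIdeal_of_degree_ne_zero hi ha)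
    by_cases hj : j = 0
    swap
    · exact Or.inr (mem_maxHomIdeal_of_degree_ne_zero hj hb)
    subst hi hj
    have hab0 : a * b ∈ 𝒜 0 := by simpa using SetLike.mul_mem_graded ha hb
    by_contra! hne
    have hua : IsUnit (⟨a, ha⟩ : 𝒜 0) := by
      by_contra hu
      exact hne.1 (Ideal.subset_span (Or.inl ⟨ha, hu⟩))
    have hub : IsUnit (⟨b, hb⟩ : 𝒜 0) := by
      by_contra hu
      exact hne.2 (Ideal.subset_span (Or.inl ⟨hb, hu⟩))
    exact not_isUnit_of_mem_maxHomIdeal hnonneg hloc hab hab0 (hua.mul hub)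

theorem le_maxHomIdeal {J : Ideal P} (hJ : J.IsHomogeneous 𝒜) (hne : J ≠ ⊤) :
    J ≤ maxHomIdeal 𝒜 := by
  intro p hp
  refine (maxHomIdeal_isHomogeneous.mem_iff 𝒜).2 fun i => ?_
  by_cases hi : i = 0
  · subst hi
    refine Ideal.subset_span (Or.inl ⟨SetLike.coe_mem _, fun hu => hne ?_⟩)
    exact J.eq_top_of_isUnit_mem (hJ 0 hp) (hu.map (SetLike.GradeZero.subring 𝒜).subtype)
  · exact mem_maxHomIdeal_of_degree_ne_zero hi (SetLike.coe_mem _)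

theorem isNilpotent_of_not_isUnit (hloc : IsLocalRing ↥(𝒜 0)) (hart : IsArtinianRing ↥(𝒜 0))
    {p : P} (hp : p ∈ 𝒜 0) (hu : ¬ IsUnit (⟨p, hp⟩ : 𝒜 0)) : IsNilpotent p := by
  have h1 : (⟨p, hp⟩ : 𝒜 0) ∈ IsLocalRing.maximalIdeal (𝒜 0) := hu
  obtain ⟨k, hk⟩ := IsArtinianRing.isNilpotent_jacobson_bot (R := 𝒜 0)
  rw [IsLocalRing.jacobson_eq_maximalIdeal ⊥ bot_ne_top] at hk
  have h2 := Ideal.pow_mem_pow h1 k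
  rw [hk] at h2
  exact ⟨k, congrArg Subtype.val (Ideal.mem_bot.1 h2)⟩

theorem maxHomIdeal_le_of_forall_pos (hnonneg : ∀ i : ℤ, i < 0 → 𝒜 i = ⊥)
    (hloc : IsLocalRing ↥(𝒜 0)) (hart : IsArtinianRing ↥(𝒜 0)) {Q : Ideal P} (hQ : Q.IsPrime)
    (hpos : ∀ d : ℕ, 0 < d → ∀ h ∈ 𝒜 d, h ∈ Q) : maxHomIdeal 𝒜 ≤ Q := by
  refine Ideal.span_le.2 ?_
  rintro p (⟨hp, hu⟩ | hp)
  · obtain ⟨k, hk⟩ := isNilpotent_of_not_isUnit hloc hart hp hu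
    exact hQ.mem_of_pow_mem k (hk ▸ Q.zero_mem)
  · obtain ⟨i, hi, hp⟩ := Set.mem_iUnion₂.1 hp
    rcases lt_or_gt_of_ne hi with hi | hi
    · rw [AddSubgroup.mem_bot.1 ((hnonneg i hi).le hp)]
      exact Q.zero_mem
    · lift i to ℕ using hi.le
      exact hpos i (by exact_mod_cast hi) p hp

theorem notMem_of_isSMulRegular [IsNoetherianRing P] {I Q : Ideal P}
    (hQ : Q ∈ associatedPrimes P (P ⧸ I)) {r : P} (hr : IsSMulRegular (P ⧸ I) r) : r ∉ Q := by
  obtain ⟨g, hg⟩ := mem_of_mem_associatedPrimes hQ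
  intro hrQ
  have h1 : r • (Ideal.Quotient.mk I g) = r • (0 : P ⧸ I) := by
    rw [smul_zero, Algebra.smul_def]
    exact Ideal.Quotient.eq_zero_iff_mem.2 ((hg r).1 hrQ)
  have h2 : g ∈ I := Ideal.Quotient.eq_zero_iff_mem.1 (hr h1)
  exact hQ.1.ne_top ((Ideal.eq_top_iff_one Q).2 ((hg 1).2 (by rwa [one_mul])))

theorem exists_homogeneous_mem_assPrimeComplement [IsNoetherianRing P]
    (hnonneg : ∀ i : ℤ, i < 0 → 𝒜 i = ⊥) (hloc : IsLocalRing ↥(𝒜 0))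
    (hart : IsArtinianRing ↥(𝒜 0)) {I : Ideal P} (hI : I.IsHomogeneous 𝒜) {r : P}
    (hr : r ∈ maxHomIdeal 𝒜) (hreg : IsSMulRegular (P ⧸ I) r) :
    ∃ d : ℕ, 0 < d ∧ ∃ x ∈ 𝒜 d, x ∈ assPrimeComplement I := by
  have hfin : (associatedPrimes P (P ⧸ I)).Finite := associatedPrimes.finite P (P ⧸ I)
  obtain ⟨d, hd, x, hx, hxQ⟩ := exists_homogeneous_notMem hnonneg hfin.toFinset
    (fun Q hQ => (hfin.mem_toFinset.1 hQ).1)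
    (fun Q hQ => isHomogeneous_of_mem_associatedPrimes hI (hfin.mem_toFinset.1 hQ))
    (fun Q hQ => by
      have hQ' := hfin.mem_toFinset.1 hQ
      by_contra! hall
      exact notMem_of_isSMulRegular hQ' hreg
        (maxHomIdeal_le_of_forall_pos hnonneg hloc hart hQ'.1 hall hr))
  exact ⟨d, hd, x, hx, fun Q hQ => hxQ Q (hfin.mem_toFinset.2 hQ)⟩

/-- In dimension one, a prime between `I` and a strictly larger prime is minimal over `I`. -/
theorem mem_minimalPrimes_of_lt {I J M : Ideal P} (hdim : ringKrullDim (P ⧸ I) ≤ 1)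
    (hJ : J.IsPrime) (hM : M.IsPrime) (hIJ : I ≤ J) (hJM : J < M) : J ∈ I.minimalPrimes := by
  refine ⟨⟨hJ, hIJ⟩, fun K hK hKJ => ?_⟩
  by_contra hJK
  have hKJ' : K < J := lt_of_le_not_ge hKJ hJK
  have hK' : K.IsPrime := hK.1
  let p : Fin 3 → PrimeSpectrum.zeroLocus (R := P) I :=
    ![⟨⟨K, hK'⟩, hK.2⟩, ⟨⟨J, hJ⟩, hIJ⟩, ⟨⟨M, hM⟩, hIJ.trans hJM.le⟩]
  let c : LTSeries (PrimeSpectrum.zeroLocus (R := P) I) := ⟨2, p, fun i => by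
    fin_cases i
    · exact hKJ'
    · exact hJM⟩
  have h1 : ((2 : ℕ) : WithBot ℕ∞) ≤ Order.krullDim (PrimeSpectrum.zeroLocus (R := P) I) :=
    le_iSup (fun q : LTSeries (PrimeSpectrum.zeroLocus (R := P) I) => (q.length : WithBot ℕ∞)) c
  rw [← ringKrullDim_quotient] at h1
  have h2 : ((2 : ℕ) : WithBot ℕ∞) ≤ 1 := h1.trans hdim
  exact absurd h2 (by decide)

theorem mem_associatedPrimes_of_mem_minimalPrimes [IsNoetherianRing P] {I Q : Ideal P}
    (hQ : Q ∈ I.minimalPrimes) : Q ∈ associatedPrimes P (P ⧸ I) := by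
  refine Module.associatedPrimes.minimalPrimes_annihilator_subset_associatedPrimes P (P ⧸ I) ?_
  rwa [Ideal.annihilator_quotient]

theorem maxHomIdeal_le_radical [IsNoetherianRing P]
    (hnonneg : ∀ i : ℤ, i < 0 → 𝒜 i = ⊥) (hloc : IsLocalRing ↥(𝒜 0)) {I : Ideal P}
    (hI : I.IsHomogeneous 𝒜) (hdim : ringKrullDim (P ⧸ I) ≤ 1) {x : P} {d : ℤ} (hx : x ∈ 𝒜 d)
    (hxW : x ∈ assPrimeComplement I) : maxHomIdeal 𝒜 ≤ (I ⊔ Ideal.span {x}).radical := by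
  have hhom : (I ⊔ Ideal.span {x}).IsHomogeneous 𝒜 :=
    hI.sup (Ideal.homogeneous_span 𝒜 _ (by rintro _ rfl; exact ⟨d, hx⟩))
  rw [hhom.radical_eq]
  refine le_sInf ?_
  rintro J ⟨hJ, hle, hJp⟩
  by_contra hnot
  have hlt : J < maxHomIdeal 𝒜 := lt_of_le_not_ge (le_maxHomIdeal hJ hJp.ne_top) hnot
  have hmin := mem_minimalPrimes_of_lt hdim hJp (maxHomIdeal_isPrime hnonneg hloc)
    (le_sup_left.trans hle) hlt
  exact hxW J (mem_associatedPrimes_of_mem_minimalPrimes hmin)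
    (hle (Ideal.mem_sup_right (Ideal.mem_span_singleton_self x)))

theorem mem_symbolicPower_iff {I : Ideal P} {t : ℕ} {f : P} :
    f ∈ symbolicPower I t ↔ ∃ w ∈ assPrimeComplement I, w * f ∈ I ^ t :=
  IsLocalization.algebraMap_mem_map_algebraMap_iff (assPrimeComplement I) _ _ _

/-- The saturation of `J` with respect to `x`. -/
def saturation (J : Ideal P) (x : P) : Ideal P where
  carrier := {f | ∃ k : ℕ, x ^ k * f ∈ J}
  zero_mem' := ⟨0, by simp⟩
  add_mem' := by
    rintro a b ⟨k, hk⟩ ⟨l, hl⟩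
    refine ⟨k + l, ?_⟩
    rw [mul_add]
    refine J.add_mem ?_ ?_
    · rw [add_comm, pow_add, mul_assoc]
      exact J.mul_mem_left _ hk
    · rw [pow_add, mul_assoc]
      exact J.mul_mem_left _ hl
  smul_mem' := by
    rintro c a ⟨k, hk⟩
    exact ⟨k, by rw [smul_eq_mul, mul_left_comm]; exact J.mul_mem_left _ hk⟩

theorem le_saturation (J : Ideal P) (x : P) : J ≤ saturation J x := fun f hf =>
  ⟨0, by simpa using hf⟩

theorem saturation_isHomogeneous {J : Ideal P} (hJ : J.IsHomogeneous 𝒜) {x : P} {d : ℤ}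
    (hx : x ∈ 𝒜 d) : (saturation J x).IsHomogeneous 𝒜 := by
  rintro i f ⟨k, hk⟩
  refine ⟨k, ?_⟩
  rw [← coe_decompose_mul_add_of_left_mem 𝒜 (SetLike.pow_mem_graded k hx)]
  exact hJ _ hk

theorem symbolicPower_eq_saturation [IsNoetherianRing P]
    (hnonneg : ∀ i : ℤ, i < 0 → 𝒜 i = ⊥) (hloc : IsLocalRing ↥(𝒜 0)) {I : Ideal P}
    (hI : I.IsHomogeneous 𝒜) (hdim : ringKrullDim (P ⧸ I) ≤ 1) {x : P} {d : ℕ} (hd : 0 < d)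
    (hx : x ∈ 𝒜 d) (hxW : x ∈ assPrimeComplement I) :
    symbolicPower I 2 = saturation (I ^ 2) x := by
  have hI2 : (I ^ 2).IsHomogeneous 𝒜 := by
    rw [pow_two]
    exact hI.mul hI
  ext f
  rw [mem_symbolicPower_iff]
  constructor
  · rintro ⟨w, hw, hwf⟩
    refine mem_of_mul_mem_of_associatedPrimes (fun Q hQ => ?_) (le_saturation _ x hwf)
    have hQp : Q.IsPrime := hQ.1
    have hQhom := isHomogeneous_of_mem_associatedPrimes (saturation_isHomogeneous hI2 hx) hQ
    obtain ⟨g, hg⟩ := mem_of_mem_associatedPrimes hQ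
    have hxQ : x ∉ Q := by
      intro h
      obtain ⟨k, hk⟩ := (hg x).1 h
      refine hQp.ne_top ((Ideal.eq_top_iff_one Q).2 ((hg 1).2 ⟨k + 1, ?_⟩))
      rwa [one_mul, pow_succ x, mul_assoc]
    have hIQ : I ≤ Q := fun a ha => hQp.mem_of_pow_mem 2
      ((hg _).2 (Ideal.mul_mem_right _ _ (le_saturation _ x (Ideal.pow_mem_pow ha 2))))
    have hlt : Q < maxHomIdeal 𝒜 := lt_of_le_not_ge (le_maxHomIdeal hQhom hQp.ne_top) fun h =>
      hxQ (h (mem_maxHomIdeal_of_degree_ne_zero (by exact_mod_cast hd.ne') hx))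
    exact hw Q (mem_associatedPrimes_of_mem_minimalPrimes
      (mem_minimalPrimes_of_lt hdim hQp (maxHomIdeal_isPrime hnonneg hloc) hIQ hlt))
  · rintro ⟨k, hk⟩
    exact ⟨x ^ k, pow_mem hxW k, hk⟩

/-- Elements of the localization of `P / I` at `x` of degree larger than the `a`-invariant come
from `P / I`. -/
theorem exists_sub_mul_mem {I : Ideal P} (hI : I.IsHomogeneous 𝒜) [IsNoetherianRing P]
    {m : ℕ} {y : Fin m → P} {e : Fin m → ℤ} (hy : ∀ j, y j ∈ 𝒜 (e j)) {x : P} {D d : ℤ}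
    (hx : x ∈ 𝒜 D) (hxW : x ∈ assPrimeComplement I)
    (hyx : ∀ j, y j ∈ (I ⊔ Ideal.span {x}).radical)
    (hxy : x ∈ (Ideal.span (Set.range y)).radical)
    (hK : KVanish y (fun j => AddSubgroup.map (Ideal.Quotient.mk I).toAddMonoidHom (𝒜 j)) e 1
      (d - D))
    {r : P} (hr : r ∈ 𝒜 d) : ∃ v ∈ 𝒜 (d - D), r - x * v ∈ I := by
  obtain ⟨t, ht⟩ : ∃ t : ℕ, ∀ j, y j ^ t ∈ I ⊔ Ideal.span {x} := by
    choose k hk using hyx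
    refine ⟨∑ j, k j, fun j => ?_⟩
    exact Ideal.pow_mem_of_pow_mem _ (hk j)
      (Finset.single_le_sum (f := k) (fun i _ => Nat.zero_le (k i)) (Finset.mem_univ j))
  have hw : ∀ j, ∃ w ∈ 𝒜 (t * e j - D), y j ^ t - x * w ∈ I := by
    intro j
    obtain ⟨a, ha, b, hb, hab⟩ := Submodule.mem_sup.1 (ht j)
    obtain ⟨w, rfl⟩ := Ideal.mem_span_singleton.1 hb
    refine ⟨decompose 𝒜 w (t * e j - D), SetLike.coe_mem _, ?_⟩
    have h1 : y j ^ t - x * w ∈ I := by rwa [← hab, add_sub_cancel_right]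
    have h2 := hI (D + (t * e j - D)) h1
    rwa [decompose_sub, DirectSum.sub_apply, AddSubgroup.coe_sub,
      coe_decompose_mul_add_of_left_mem 𝒜 hx, add_sub_cancel, decompose_of_mem_same] at h2
    simpa using SetLike.pow_mem_graded t (hy j)
  choose w hw hyw using hw
  obtain ⟨s, g, hg⟩ := exists_of_kVanish_one hK t (fun j => w j * r)
    (fun j => by
      have := SetLike.mul_mem_graded (hw j) hr
      rwa [show t * e j - D + d = d - D + t * e j by ring] at this)
    (fun i j => by
      have h1 := I.mul_mem_left (w j * r) (hyw i)
      have h2 := I.mul_mem_left (w i * r) (hyw j)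
      convert I.sub_mem h1 h2 using 1
      ring)
  have hz : ∀ j, y j ^ (t + s) * (r - x * g) ∈ I := by
    intro j
    have h1 := I.mul_mem_left (y j ^ s * r) (hyw j)
    have h2 := I.mul_mem_left x (hg j)
    convert I.sub_mem h1 h2 using 1
    ring
  obtain ⟨k, hk⟩ : ∃ k : ℕ, x ^ k * (r - x * g) ∈ I := by
    have hle : Ideal.span (Set.range y) ≤ (I.colon {r - x * g}).radical := by
      rw [Ideal.span_le]
      rintro _ ⟨j, rfl⟩
      exact ⟨t + s, Submodule.mem_colon_singleton.2 (hz j)⟩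
    obtain ⟨k, hk⟩ := Ideal.radical_le_radical_iff.2 hle hxy
    exact ⟨k, Submodule.mem_colon_singleton.1 hk⟩
  have h1 : r - x * g ∈ I := mem_of_mul_mem_of_associatedPrimes (pow_mem hxW k) hk
  have h2 := hI (D + (d - D)) h1
  refine ⟨decompose 𝒜 g (d - D), SetLike.coe_mem _, ?_⟩
  rwa [decompose_sub, DirectSum.sub_apply, AddSubgroup.coe_sub,
    coe_decompose_mul_add_of_left_mem 𝒜 hx, add_sub_cancel, decompose_of_mem_same 𝒜 hr] at h2

theorem exists_sum_of_mem_span {S : Set P} {b : ℤ} (hS : S ⊆ ⋃ (j : ℤ) (_ : j ≤ b), (𝒜 j : Set P))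
    {f : P} {ℓ : ℤ} (hf : f ∈ Ideal.span S) (hfℓ : f ∈ 𝒜 ℓ) :
    ∃ (n : ℕ) (a g : Fin n → P) (c : Fin n → ℤ), (∀ i, g i ∈ S) ∧ (∀ i, c i ≤ b) ∧
      (∀ i, g i ∈ 𝒜 (c i)) ∧ (∀ i, a i ∈ 𝒜 (ℓ - c i)) ∧ f = ∑ i, a i * g i := by
  obtain ⟨n, a, g, hag⟩ := Submodule.mem_span_set'.1 hf
  have hg : ∀ i, ∃ c : ℤ, c ≤ b ∧ (g i : P) ∈ 𝒜 c := fun i => by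
    obtain ⟨c, hc, h⟩ := Set.mem_iUnion₂.1 (hS (g i).2)
    exact ⟨c, hc, h⟩
  choose c hcb hc using hg
  refine ⟨n, fun i => decompose 𝒜 (a i) (ℓ - c i), fun i => g i, c, fun i => (g i).2, hcb, hc,
    fun i => SetLike.coe_mem _, ?_⟩
  have h1 := decompose_of_mem_same 𝒜 hfℓ
  rw [← hag, decompose_sum, DFinsupp.finsetSum_apply, AddSubgroup.val_finsetSum, hag] at h1
  rw [← h1]
  refine Finset.sum_congr rfl fun i _ => ?_
  conv_lhs => rw [show ℓ = ℓ - c i + c i by ring]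
  exact coe_decompose_mul_add_of_right_mem 𝒜 (hc i)

theorem saturation_le [IsNoetherianRing P] {I : Ideal P} {x : P} (hxW : x ∈ assPrimeComplement I) :
    saturation (I ^ 2) x ≤ I := by
  rintro f ⟨k, hk⟩
  exact mem_of_mul_mem_of_associatedPrimes (pow_mem hxW k) (Ideal.pow_le_self two_ne_zero hk)

theorem mem_saturation_of_mul_mem {J : Ideal P} {x f : P} (h : x * f ∈ saturation J x) :
    f ∈ saturation J x := by
  obtain ⟨k, hk⟩ := h
  exact ⟨k + 1, by rwa [pow_succ, mul_assoc]⟩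

/-- Suppose homogeneous elements of degree greater than `γ` in the localization of `P / I` at `x`
come from `P / I`. Then homogeneous elements of large degree in the saturation of `I ^ 2` lie,
modulo `I ^ 2`, in the product of the maximal homogeneous ideal and the saturation. -/
theorem exists_sum_sub_mem_sq [IsNoetherianRing P] {I : Ideal P} (hI : I.IsHomogeneous 𝒜)
    {x : P} {D : ℤ} (hx : x ∈ 𝒜 D) (hxW : x ∈ assPrimeComplement I) (hxm : x ∈ maxHomIdeal 𝒜)
    {β δ γ : ℤ} (hβ : IdealGenDegLE 𝒜 I β)
    (hδ : maxHomIdeal 𝒜 ≤ I ⊔ Ideal.span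
      ((maxHomIdeal 𝒜 : Set P) ∩ ⋃ (j : ℤ) (_ : j ≤ δ), (𝒜 j : Set P)))
    (hγ : ∀ d : ℤ, γ < d - D → ∀ r ∈ 𝒜 d, ∃ v ∈ 𝒜 (d - D), r - x * v ∈ I)
    {ℓ : ℤ} (hℓ : β + δ + γ < ℓ) {f : P} (hf : f ∈ saturation (I ^ 2) x) (hfℓ : f ∈ 𝒜 ℓ) :
    ∃ (n : ℕ) (u z : Fin n → P) (c : Fin n → ℤ),
      (∀ i, z i ∈ maxHomIdeal 𝒜) ∧ (∀ i, z i ∈ 𝒜 (c i)) ∧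
      (∀ i, u i ∈ saturation (I ^ 2) x) ∧ (∀ i, u i ∈ 𝒜 (ℓ - c i)) ∧
      f - ∑ i, u i * z i ∈ I ^ 2 := by
  obtain ⟨q, a, g, b, hgI, hbβ, hgb, hab, hfsum⟩ :=
    exists_sum_of_mem_span Set.inter_subset_right (hβ (saturation_le hxW hf)) hfℓ
  obtain ⟨x₁, hx₁, x₂, hx₂, hx₁₂⟩ := Submodule.mem_sup.1 (hδ hxm)
  have hhom : (Ideal.span ((maxHomIdeal 𝒜 : Set P) ∩
      ⋃ (j : ℤ) (_ : j ≤ δ), (𝒜 j : Set P))).IsHomogeneous 𝒜 := by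
    refine Ideal.homogeneous_span 𝒜 _ ?_
    rintro p ⟨-, hp⟩
    obtain ⟨j, -, hp⟩ := Set.mem_iUnion₂.1 hp
    exact ⟨j, hp⟩
  obtain ⟨n, c, z, d, hzm, hdδ, hzd, hcd, hxsum⟩ :=
    exists_sum_of_mem_span Set.inter_subset_right (hhom D hx₂) (SetLike.coe_mem _)
  have hxz : x - ∑ i, c i * z i ∈ I := by
    have h1 : x - x₂ ∈ I := by rwa [← hx₁₂, add_sub_cancel_right]
    have h2 := hI D h1
    rwa [decompose_sub, DirectSum.sub_apply, AddSubgroup.coe_sub, decompose_of_mem_same 𝒜 hx,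
      hxsum] at h2
  have hv : ∀ i k, ∃ v ∈ 𝒜 (ℓ - d i - b k), c i * a k - x * v ∈ I := by
    intro i k
    have h1 := SetLike.mul_mem_graded (hcd i) (hab k)
    have h2 := hdδ i
    have h3 := hbβ k
    obtain ⟨v, hv, hv'⟩ := hγ _ (by linarith) _ h1
    exact ⟨v, by rwa [show D - d i + (ℓ - b k) - D = ℓ - d i - b k by ring] at hv, hv'⟩
  choose v hv hvI using hv
  refine ⟨n, fun i => ∑ k, v i k * g k, z, d, fun i => (hzm i).1, hzd, fun i => ?_,
    fun i => ?_, ?_⟩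
  · refine mem_saturation_of_mul_mem ?_
    have h1 : c i * f - x * ∑ k, v i k * g k ∈ I ^ 2 := by
      rw [hfsum, Finset.mul_sum, Finset.mul_sum, ← Finset.sum_sub_distrib]
      refine Ideal.sum_mem _ fun k _ => ?_
      rw [← mul_assoc, ← mul_assoc, ← sub_mul, pow_two]
      exact Ideal.mul_mem_mul (hvI i k) (hgI k).1
    have h2 := (saturation (I ^ 2) x).sub_mem ((saturation (I ^ 2) x).mul_mem_left (c i) hf)
      (le_saturation _ x h1)
    rwa [sub_sub_cancel] at h2
  · refine AddSubgroup.sum_mem _ fun k _ => ?_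
    have := SetLike.mul_mem_graded (hv i k) (hgb k)
    rwa [sub_add_cancel] at this
  · have h1 : f - ∑ i, (∑ k, v i k * g k) * z i = ∑ k, (a k - ∑ i, v i k * z i) * g k := by
      simp only [sub_mul, Finset.sum_sub_distrib, hfsum, Finset.sum_mul]
      rw [Finset.sum_comm]
      simp only [mul_right_comm]
    rw [h1, pow_two]
    refine Ideal.sum_mem _ fun k _ => Ideal.mul_mem_mul ?_ (hgI k).1
    refine mem_of_mul_mem_of_associatedPrimes hxW ?_
    have h2 : x * (a k - ∑ i, v i k * z i) =
        (x - ∑ i, c i * z i) * a k + ∑ i, (c i * a k - x * v i k) * z i := by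
      simp only [sub_mul, mul_sub, Finset.sum_sub_distrib, Finset.sum_mul, Finset.mul_sum,
        mul_right_comm (c _) (a k), mul_assoc x]
      ring
    rw [h2]
    exact I.add_mem (I.mul_mem_right _ hxz)
      (I.sum_mem fun i _ => I.mul_mem_right _ (hvI i k))

theorem sq_le_span_inter {I H : Ideal P} (hIH : I ^ 2 ≤ H) {β b : ℤ} (hβ : IdealGenDegLE 𝒜 I β)
    (hb : 2 * β ≤ b) :
    I ^ 2 ≤ Ideal.span ((H : Set P) ∩ ⋃ (j : ℤ) (_ : j ≤ b), (𝒜 j : Set P)) := by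
  rw [pow_two]
  refine (Ideal.mul_mono hβ hβ).trans ?_
  rw [Ideal.span_mul_span', Ideal.span_le]
  rintro _ ⟨p, ⟨hpI, hp⟩, q, ⟨hqI, hq⟩, rfl⟩
  obtain ⟨i, hi, hp⟩ := Set.mem_iUnion₂.1 hp
  obtain ⟨j, hj, hq⟩ := Set.mem_iUnion₂.1 hq
  refine Ideal.subset_span ⟨hIH ?_, Set.mem_iUnion₂.2 ⟨i + j, by omega, ?_⟩⟩
  · rw [pow_two]
    exact Ideal.mul_mem_mul hpI hqI
  · exact SetLike.mul_mem_graded hp hq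

/-- A graded form of Nakayama's lemma. -/
theorem idealGenDegLE_of_forall_sum [IsNoetherianRing P] (hnonneg : ∀ i : ℤ, i < 0 → 𝒜 i = ⊥)
    (hloc : IsLocalRing ↥(𝒜 0)) (hart : IsArtinianRing ↥(𝒜 0)) {H : Ideal P}
    (hH : H.IsHomogeneous 𝒜) {b : ℤ}
    (hstep : ∀ ℓ : ℤ, b < ℓ → ∀ f ∈ H, f ∈ 𝒜 ℓ →
      ∃ (n : ℕ) (u z : Fin n → P) (c : Fin n → ℤ),
        (∀ i, z i ∈ maxHomIdeal 𝒜) ∧ (∀ i, z i ∈ 𝒜 (c i)) ∧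
        (∀ i, u i ∈ H) ∧ (∀ i, u i ∈ 𝒜 (ℓ - c i)) ∧
        f - ∑ i, u i * z i ∈
          Ideal.span ((H : Set P) ∩ ⋃ (j : ℤ) (_ : j ≤ b), (𝒜 j : Set P))) :
    IdealGenDegLE 𝒜 H b := by
  set J := Ideal.span ((H : Set P) ∩ ⋃ (j : ℤ) (_ : j ≤ b), (𝒜 j : Set P)) with hJ
  have hneg : ∀ {i : ℤ} {p : P}, i < 0 → p ∈ 𝒜 i → p = 0 := fun hi hp =>
    AddSubgroup.mem_bot.1 ((hnonneg _ hi).le hp)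
  obtain ⟨K, hK⟩ := IsNoetherianRing.isNilpotent_nilradical P
  have key : ∀ (ℓ : ℕ) (f : P), f ∈ H → f ∈ 𝒜 ℓ → f ∈ J := by
    intro ℓ
    induction ℓ using Nat.strong_induction_on with
    | _ ℓ ih =>
      by_cases hℓ : (ℓ : ℤ) ≤ b
      · exact fun f hf hfℓ => Ideal.subset_span ⟨hf, Set.mem_iUnion₂.2 ⟨ℓ, hℓ, hfℓ⟩⟩
      have hpow : ∀ (k : ℕ) (f : P), f ∈ H → f ∈ 𝒜 ℓ → f ∈ J ⊔ nilradical P ^ k := by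
        intro k
        induction k with
        | zero => simp
        | succ k ihk =>
          intro f hf hfℓ
          obtain ⟨n, u, z, c, hzm, hzc, huH, huc, hsum⟩ := hstep ℓ (not_le.1 hℓ) f hf hfℓ
          rw [← sub_add_cancel f (∑ i, u i * z i)]
          refine Ideal.add_mem _ (Ideal.mem_sup_left hsum) (Ideal.sum_mem _ fun i _ => ?_)
          rcases lt_trichotomy (c i) 0 with hci | hci | hci
          · rw [hneg hci (hzc i), mul_zero]
            exact Ideal.zero_mem _
          · have hz0 := hzc i
            have hu0 := huc i
            rw [hci] at hz0
            rw [hci, sub_zero] at hu0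
            have hz : z i ∈ nilradical P := mem_nilradical.2 (isNilpotent_of_not_isUnit hloc hart
              hz0 (not_isUnit_of_mem_maxHomIdeal hnonneg hloc (hzm i) hz0))
            have h1 := Ideal.mul_mem_mul (ihk (u i) (huH i) hu0) hz
            rw [Ideal.sup_mul, ← pow_succ] at h1
            have h2 : J * nilradical P ≤ J := Ideal.mul_le_left
            exact sup_le_sup_right h2 (nilradical P ^ (k + 1)) h1
          · refine Ideal.mem_sup_left (J.mul_mem_right _ ?_)
            by_cases hd : (ℓ : ℤ) - c i < 0
            · rw [hneg hd (huc i)]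
              exact J.zero_mem
            · refine ih ((ℓ : ℤ) - c i).toNat (by omega) (u i) (huH i) ?_
              rw [Int.toNat_of_nonneg (not_lt.1 hd)]
              exact huc i
      intro f hf hfℓ
      simpa [hK] using hpow K f hf hfℓ
  have hJhom : J.IsHomogeneous 𝒜 := by
    refine Ideal.homogeneous_span 𝒜 _ ?_
    rintro p ⟨-, hp⟩
    obtain ⟨j, -, hp⟩ := Set.mem_iUnion₂.1 hp
    exact ⟨j, hp⟩
  intro f hf
  refine (hJhom.mem_iff 𝒜).2 fun i => ?_
  by_cases hi : i < 0
  · rw [hneg hi (SetLike.coe_mem _)]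
    exact J.zero_mem
  · lift i to ℕ using not_lt.1 hi
    exact key i _ (hH i hf) (SetLike.coe_mem _)

theorem exists_isSMulRegular_of_depthGE_one {I : Ideal P} {N : Type} [AddCommGroup N] [Module P N]
    [Nontrivial N] (h : depthGE I N 1) : ∃ r ∈ I, IsSMulRegular N r := by
  rcases h with h | ⟨rs, hlen, hrs, hreg⟩
  · exact absurd h (not_subsingleton N)
  · obtain ⟨r, rfl⟩ := List.length_eq_one_iff.1 hlen
    exact ⟨r, hrs r (by simp),
      ((RingTheory.Sequence.isWeaklyRegular_cons_iff N r []).1 hreg.1).1⟩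

end Graded

theorem statement10
    (𝒜 : ℤ → AddSubgroup P) [GradedRing 𝒜]
    (hNoeth : IsNoetherianRing P)
    (hnonneg : ∀ i : ℤ, i < 0 → 𝒜 i = ⊥)
    -- `P₀` is an Artinian local ring
    (hloc : IsLocalRing ↥(𝒜 0)) (hart : IsArtinianRing ↥(𝒜 0))
    -- `I` is a homogeneous ideal with `R = P/I` Cohen–Macaulay of dimension one
    (I : Ideal P) (hIhom : Ideal.IsHomogeneous 𝒜 I)
    (hdim : ringKrullDim (P ⧸ I) = (1 : WithBot (WithTop ℕ)))
    (hCM : depthGE (maxHomIdeal 𝒜) (P ⧸ I) 1) :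
    -- conclusion: `b₀(I⁽²⁾) ≤ max{ b₀(I) + b₀(𝔪) + a(R), 2 b₀(I) }`
    ∀ (m : ℕ) (y : Fin m → P) (e : Fin m → ℤ),
      (∀ j, y j ∈ 𝒜 (e j)) →
      (Ideal.span (Set.range y)).radical = (maxHomIdeal 𝒜).radical →
      ∀ β δ γ : ℤ,
        -- `b₀(I) ≤ β`
        IdealGenDegLE 𝒜 I β →
        -- `b₀(𝔪) ≤ δ`, where `𝔪 = 𝔪_P/I` is the maximal homogeneous ideal of `R = P/I`
        (maxHomIdeal 𝒜 ≤ I ⊔ Ideal.span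
          ((maxHomIdeal 𝒜 : Set P) ∩ ⋃ (j : ℤ) (_ : j ≤ δ), (𝒜 j : Set P))) →
        -- `a(R) ≤ γ`:  `[H¹_𝔪(R)]_ℓ = 0` for `ℓ > γ`, via Koszul cohomology of `P/I`
        (∀ ℓ : ℤ, γ < ℓ → KVanish y
          (fun j => AddSubgroup.map (Ideal.Quotient.mk I).toAddMonoidHom (𝒜 j)) e 1 ℓ) →
        IdealGenDegLE 𝒜 (symbolicPower I 2) (max (β + δ + γ) (2 * β)) := by
  intro m y e hy hrad β δ γ hβ hδ hγ
  have hnt : Nontrivial (P ⧸ I) := by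
    by_contra hnot
    rw [not_nontrivial_iff_subsingleton] at hnot
    rw [ringKrullDim_eq_bot_of_subsingleton] at hdim
    exact WithBot.bot_ne_coe hdim
  obtain ⟨r, hr, hreg⟩ := exists_isSMulRegular_of_depthGE_one hCM
  obtain ⟨D, hD, x, hx, hxW⟩ :=
    exists_homogeneous_mem_assPrimeComplement hnonneg hloc hart hIhom hr hreg
  have hxm : x ∈ maxHomIdeal 𝒜 :=
    mem_maxHomIdeal_of_degree_ne_zero (by exact_mod_cast hD.ne') hx
  have hmrad := maxHomIdeal_le_radical hnonneg hloc hIhom hdim.le hx hxW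
  have hyx : ∀ j, y j ∈ (I ⊔ Ideal.span {x}).radical := fun j => by
    have h1 : y j ∈ (maxHomIdeal 𝒜).radical :=
      hrad ▸ Ideal.le_radical (Ideal.subset_span ⟨j, rfl⟩)
    exact hmrad (by rwa [(maxHomIdeal_isPrime hnonneg hloc).radical] at h1)
  have hxy : x ∈ (Ideal.span (Set.range y)).radical := hrad ▸ Ideal.le_radical hxm
  have hI2 : (I ^ 2).IsHomogeneous 𝒜 := by
    rw [pow_two]
    exact hIhom.mul hIhom
  rw [symbolicPower_eq_saturation hnonneg hloc hIhom hdim.le hD hx hxW]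
  refine idealGenDegLE_of_forall_sum hnonneg hloc hart (saturation_isHomogeneous hI2 hx)
    fun ℓ hℓ f hf hfℓ => ?_
  obtain ⟨n, u, z, c, hzm, hzc, hu, huc, hsum⟩ := exists_sum_sub_mem_sq hIhom hx hxW hxm hβ hδ
    (fun d hd r hr => exists_sub_mul_mem hIhom hy hx hxW hyx hxy (hγ _ hd) hr)
    ((le_max_left _ _).trans_lt hℓ) hf hfℓ
  exact ⟨n, u, z, c, hzm, hzc, hu, huc,
    sq_le_span_inter (le_saturation _ x) hβ (le_max_right _ _) hsum⟩

end Paper
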